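/- arXiv:1303.4517 — 3 statements merged into one kernel-verified Lean document; each statement's English description precedes it below -/
import Mathlib

section
/- Let G be a conference graph of order v > 9, i.e., a connected strongly regular graph with parameters (v, (v-1)/2, (v-5)/4, (v-1)/4). Then G is optimistic: the distance matrix D of G has strictly more positive eigenvalues than negative eigenvalues, i.e., n₊(G) > n₋(G). -/
open Matrix Finset

/-- The distance matrix of a graph, as a real matrix. -/
noncomputable def distMatrix {V : Type*} [Fintype V] (G : SimpleGraph V) : Matrix V V ℝ :=
  Matrix.of fun u v => (G.dist u v : ℝ)

open SimpleGraph in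
lemma cg_distMatrix {V : Type*} [Fintype V] [DecidableEq V]
    (G : SimpleGraph V) [DecidableRel G.Adj] (v k ℓ μ : ℕ) (hm : μ ≠ 0)
    (hsrg : G.IsSRGWith v k ℓ μ) :
    distMatrix G = (2 : ℝ) • Matrix.of (fun _ _ => (1 : ℝ)) - (2 : ℝ) • 1 - G.adjMatrix ℝ := by
  ext u w
  by_cases h : u = w
  · subst h
    simp [distMatrix]
  · by_cases ha : G.Adj u w
    · have : G.dist u w = 1 := dist_eq_one_iff_adj.mpr ha
      simp [distMatrix, this, ha, h]
      norm_num
    · have hc := hsrg.of_not_adj h ha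
      have hne : (G.commonNeighbors u w).Nonempty := by
        by_contra hn
        rw [Set.not_nonempty_iff_eq_empty] at hn
        simp [hn] at hc
        omega
      have : G.dist u w = 2 := by
        unfold SimpleGraph.dist
        rw [edist_eq_two_iff.mpr ⟨h, ha, hne⟩]
        rfl
      simp [distMatrix, this, ha, h]

lemma cg_trace_sq {V : Type*} [Fintype V] [DecidableEq V] (D : Matrix V V ℝ)
    (hD : D.IsHermitian) : (D * D).trace = ∑ i, hD.eigenvalues i ^ 2 := by
  have h := hD.spectral_theorem
  have h2 : D * D = Unitary.conjStarAlgAut ℝ _ hD.eigenvectorUnitary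
      (diagonal (RCLike.ofReal ∘ hD.eigenvalues) * diagonal (RCLike.ofReal ∘ hD.eigenvalues)) := by
    rw [map_mul, ← h]
  rw [h2, Unitary.conjStarAlgAut_apply, Matrix.trace_mul_comm, ← mul_assoc]
  simp [Matrix.trace, pow_two]

lemma cg_quad {V : Type*} [Fintype V] [DecidableEq V]
    (G : SimpleGraph V) [DecidableRel G.Adj] (v k ℓ μ : ℕ)
    (hk : v = 2 * k + 1) (hℓ : v = 4 * ℓ + 5) (hμ : v = 4 * μ + 1)
    (hsrg : G.IsSRGWith v k ℓ μ) (u w : V) :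
    (distMatrix G * distMatrix G) u w + 3 * distMatrix G u w
      + ((9 - v) / 4 : ℝ) * (1 : Matrix V V ℝ) u w = 9 * μ + 2 := by
  have hm : μ ≠ 0 := by omega
  rw [cg_distMatrix G v k ℓ μ hm hsrg]
  have hA := hsrg.matrix_eq (α := ℝ)
  have hA' := congrFun (congrFun hA u) w
  rw [pow_two] at hA'
  set J : Matrix V V ℝ := Matrix.of (fun _ _ => (1 : ℝ)) with hJ
  set A := G.adjMatrix ℝ with hAd
  have hJJ : (J * J) u w = v := by
    simp [Matrix.mul_apply, hJ, hsrg.card]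
  have hJA : (J * A) u w = k := by
    simp [hAd, SimpleGraph.mul_adjMatrix_apply, hJ, hsrg.regular.degree_eq]
  have hAJ : (A * J) u w = k := by
    simp [hAd, SimpleGraph.adjMatrix_mul_apply, hJ, hsrg.regular.degree_eq]
  have hC : Gᶜ.adjMatrix ℝ u w = 1 - (1 : Matrix V V ℝ) u w - A u w := by
    by_cases h : u = w
    · subst h; simp [hAd]
    · by_cases ha : G.Adj u w <;> simp [hAd, h, ha]
  have hJe : J u w = 1 := rfl
  simp only [Matrix.add_apply, Matrix.smul_apply, hC] at hA'
  simp only [nsmul_eq_mul] at hA'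
  simp only [sub_mul, mul_sub, Matrix.smul_mul, Matrix.mul_smul, Matrix.sub_apply,
    Matrix.smul_apply, smul_eq_mul, mul_one, one_mul, hJJ, hJA, hAJ, hA', hJe]
  have e1 : (k : ℝ) = 2 * μ := by
    have : k = 2 * μ := by omega
    subst this; push_cast; ring
  have e2 : (v : ℝ) = 4 * μ + 1 := by rw [hμ]; push_cast; ring
  have e3 : (ℓ : ℝ) = μ - 1 := by
    have : μ = ℓ + 1 := by omega
    subst this; push_cast; ring
  rw [e1, e2, e3]
  ring

lemma cg_eig {V : Type*} [Fintype V] [DecidableEq V]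
    (G : SimpleGraph V) [DecidableRel G.Adj] (v k ℓ μ : ℕ)
    (hk : v = 2 * k + 1) (hℓ : v = 4 * ℓ + 5) (hμ : v = 4 * μ + 1)
    (hsrg : G.IsSRGWith v k ℓ μ) (hD : (distMatrix G).IsHermitian) (i : V) :
    hD.eigenvalues i = 3 * k ∨
      hD.eigenvalues i ^ 2 + 3 * hD.eigenvalues i + ((9 - v) / 4 : ℝ) = 0 := by
  have hm : μ ≠ 0 := by omega
  have hx := hD.mulVec_eigenvectorBasis i
  have hx0 : (hD.eigenvectorBasis i).ofLp ≠ 0 := by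
    intro h
    apply hD.eigenvectorBasis.orthonormal.ne_zero i
    ext j
    exact congrFun h j
  set x : V → ℝ := (hD.eigenvectorBasis i).ofLp
  set t := hD.eigenvalues i
  have hcol : ∀ w, ∑ u, distMatrix G u w = 3 * k := by
    intro w
    have hA1 : ∑ u, G.adjMatrix ℝ u w = k := by
      have := SimpleGraph.mul_adjMatrix_apply (G := G) (Matrix.of (fun _ _ => (1 : ℝ))) w w
      simp [Matrix.mul_apply, hsrg.regular.degree_eq] at this
      simpa using this
    rw [cg_distMatrix G v k ℓ μ hm hsrg]
    simp only [Matrix.sub_apply, Finset.sum_sub_distrib, hA1]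
    simp [hsrg.card, Matrix.one_apply]
    rw [hk]; push_cast; ring
  have hsum : t * ∑ u, x u = 3 * k * ∑ u, x u := by
    have h1 : ∑ u, (distMatrix G *ᵥ x) u = t * ∑ u, x u := by
      rw [hx]; simp [Finset.mul_sum]
    rw [← h1]
    simp only [Matrix.mulVec, dotProduct]
    rw [Finset.sum_comm]
    simp only [← Finset.sum_mul, hcol, Finset.mul_sum]
  by_cases ht : t = 3 * k
  · exact Or.inl ht
  right
  have hs : ∑ u, x u = 0 := by
    have : (t - 3 * k) * ∑ u, x u = 0 := by linarith
    exact (mul_eq_zero.mp this).resolve_left (sub_ne_zero.mpr ht)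
  obtain ⟨u, hu⟩ := Function.ne_iff.mp hx0
  have h2 : ((distMatrix G * distMatrix G) *ᵥ x) u = t ^ 2 * x u := by
    rw [← Matrix.mulVec_mulVec, hx, Matrix.mulVec_smul, hx]
    simp; ring
  have h1 : (distMatrix G *ᵥ x) u = t * x u := by rw [hx]; simp
  have h0 : ((1 : Matrix V V ℝ) *ᵥ x) u = x u := by simp
  have key : (t ^ 2 + 3 * t + ((9 - v) / 4 : ℝ)) * x u = 0 := by
    calc _ = ((distMatrix G * distMatrix G) *ᵥ x) u + 3 * (distMatrix G *ᵥ x) u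
          + ((9 - v) / 4 : ℝ) * ((1 : Matrix V V ℝ) *ᵥ x) u := by rw [h2, h1, h0]; ring
      _ = ∑ w, (9 * μ + 2 : ℝ) * x w := by
        simp only [Matrix.mulVec, dotProduct, Finset.mul_sum, ← Finset.sum_add_distrib]
        refine Finset.sum_congr rfl fun w _ => ?_
        rw [← cg_quad G v k ℓ μ hk hℓ hμ hsrg u w]; ring
      _ = 0 := by rw [← Finset.mul_sum, hs, mul_zero]
  exact (mul_eq_zero.mp key).resolve_right hu

/-- Every conference graph of order `v > 9`, i.e. every connected strongly regular graph
with parameters `(v, (v-1)/2, (v-5)/4, (v-1)/4)`, is optimistic: its distance matrix has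
strictly more positive than negative eigenvalues. -/
theorem conference_graph_optimistic {V : Type*} [Fintype V] [DecidableEq V]
    (G : SimpleGraph V) [DecidableRel G.Adj] (v k ℓ μ : ℕ)
    (hv : 9 < v) (hk : v = 2 * k + 1) (hℓ : v = 4 * ℓ + 5) (hμ : v = 4 * μ + 1)
    (hsrg : G.IsSRGWith v k ℓ μ) (hconn : G.Connected)
    (hD : (distMatrix G).IsHermitian) :
    (Finset.univ.filter fun i => hD.eigenvalues i < 0).card <
      (Finset.univ.filter fun i => 0 < hD.eigenvalues i).card := by
  have hm : μ ≠ 0 := by omega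
  have hvR : (9 : ℝ) < v := by exact_mod_cast hv
  have e1 : (v : ℝ) = 2 * k + 1 := by rw [hk]; push_cast; ring
  have e2 : (v : ℝ) = 4 * μ + 1 := by rw [hμ]; push_cast; ring
  have htr : (distMatrix G).trace = 0 := by simp [Matrix.trace, distMatrix]
  have hS1 : ∑ i, hD.eigenvalues i = 0 := by
    have := hD.trace_eq_sum_eigenvalues
    rw [htr] at this
    simpa using this.symm
  have hcard : (Fintype.card V : ℝ) = v := by rw [hsrg.card]
  have hQ : ∑ i, (hD.eigenvalues i ^ 2 + 3 * hD.eigenvalues i + ((9 - v) / 4 : ℝ))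
      = (v : ℝ) * (9 * μ + 2) := by
    have h := Finset.sum_congr (rfl : (Finset.univ : Finset V) = Finset.univ)
      (fun u _ => cg_quad G v k ℓ μ hk hℓ hμ hsrg u u)
    rw [Finset.sum_add_distrib, Finset.sum_add_distrib, ← Finset.mul_sum] at h ⊢
    have h3 := cg_trace_sq _ hD
    simp only [Matrix.trace, Matrix.diag_apply] at h3 htr
    rw [h3, htr] at h
    rw [hS1]
    simpa [hcard, mul_add] using h
  set s := Real.sqrt v with hs
  have hs2 : s * s = v := Real.mul_self_sqrt (by positivity)
  have hs3 : 3 < s := by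
    rw [hs]; apply Real.lt_sqrt_of_sq_lt; linarith
  have hq : (0 : ℝ) < v * (9 * μ + 2) := by positivity
  have hterm : ∀ i, s * (v * (9 * μ + 2)) *
      ((if 0 < hD.eigenvalues i then (1 : ℝ) else 0) - (if hD.eigenvalues i < 0 then (1 : ℝ) else 0))
      = (2 * hD.eigenvalues i + 3) * (v * (9 * μ + 2)) + (s - 3 * v) *
        (hD.eigenvalues i ^ 2 + 3 * hD.eigenvalues i + ((9 - v) / 4 : ℝ)) := by
    intro i
    rcases cg_eig G v k ℓ μ hk hℓ hμ hsrg hD i with h | h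
    · have hk0 : (0 : ℝ) < 3 * k := by linarith
      rw [h, if_pos hk0, if_neg (not_lt.mpr hk0.le)]
      have e3 : (k : ℝ) = 2 * μ := by linarith
      rw [e3, e2]; ring
    · rw [h]
      have : (2 * hD.eigenvalues i + 3 - s) * (2 * hD.eigenvalues i + 3 + s) = 0 := by
        linear_combination 4 * h - hs2
      rcases mul_eq_zero.mp this with h' | h'
      · have hp : 0 < hD.eigenvalues i := by linarith
        rw [if_pos hp, if_neg (not_lt.mpr hp.le)]
        linear_combination (-(v * (9 * μ + 2)) : ℝ) * h'
      · have hp : hD.eigenvalues i < 0 := by linarith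
        rw [if_pos hp, if_neg (not_lt.mpr hp.le)]
        linear_combination (-(v * (9 * μ + 2)) : ℝ) * h'
  have hsum := Finset.sum_congr (rfl : (Finset.univ : Finset V) = Finset.univ)
    (fun i _ => hterm i)
  rw [← Finset.mul_sum, Finset.sum_sub_distrib, Finset.sum_boole, Finset.sum_boole,
    Finset.sum_add_distrib, ← Finset.mul_sum, ← Finset.sum_mul, hQ, Finset.sum_add_distrib,
    ← Finset.mul_sum, hS1, Finset.sum_const, Finset.card_univ, nsmul_eq_mul, hcard] at hsum
  have hfin : (s * (v * (9 * μ + 2))) *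
      (((Finset.univ.filter fun i => 0 < hD.eigenvalues i).card : ℝ) -
        ((Finset.univ.filter fun i => hD.eigenvalues i < 0).card : ℝ) - 1) = 0 := by
    linear_combination hsum
  have hne : s * (v * (9 * μ + 2)) ≠ 0 := by positivity
  have := (mul_eq_zero.mp hfin).resolve_left hne
  have hlt : ((Finset.univ.filter fun i => hD.eigenvalues i < 0).card : ℝ) <
      ((Finset.univ.filter fun i => 0 < hD.eigenvalues i).card : ℝ) := by linarith
  exact_mod_cast hlt
end

section
/- Let q be a prime power with q ≡ 1 (mod 4) and q > 9. Then the Paley graph P(q) is optimistic: its distance matrix has strictly more positive than negative eigenvalues, i.e., n₊(P(q)) > n₋(P(q)). -/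
open Matrix Finset

/-- The Paley graph on a finite field `F`: distinct vertices `a` and `b` are adjacent when
`a - b` (or `b - a`) is a square.  When `Fintype.card F ≡ 1 [MOD 4]`, `-1` is a square, so
adjacency is simply "`a ≠ b` and `a - b` is a (nonzero) square". -/
def paleyGraph (F : Type*) [Field F] : SimpleGraph F :=
  SimpleGraph.fromRel fun a b => IsSquare (a - b)

section PaleyAux

variable {F : Type*} [Field F] [Fintype F] [DecidableEq F]

/-- real valued quadratic character -/
noncomputable def pchi (F : Type*) [Field F] [Fintype F] [DecidableEq F] (x : F) : ℝ :=
  ((quadraticChar F x : ℤ) : ℝ)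

lemma pchi_zero : pchi F 0 = 0 := by simp [pchi]

lemma p_char_ne_two (h : Fintype.card F % 4 = 1) : ringChar F ≠ 2 := by
  intro h2
  have := FiniteField.even_card_of_char_two h2
  omega

lemma pchi_neg (h : Fintype.card F % 4 = 1) (x : F) : pchi F (-x) = pchi F x := by
  have h1 : IsSquare (-1 : F) := by
    rw [FiniteField.isSquare_neg_one_iff]; omega
  have h2 : quadraticChar F (-1) = 1 :=
    (quadraticChar_one_iff_isSquare (neg_ne_zero.mpr one_ne_zero)).mpr h1
  unfold pchi
  rw [neg_eq_neg_one_mul, map_mul, h2, one_mul]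

lemma pchi_sq {x : F} (hx : x ≠ 0) : pchi F x * pchi F x = 1 := by
  have := quadraticChar_sq_one hx
  unfold pchi
  rw [← sq]; exact_mod_cast this

lemma pchi_cases {x : F} (hx : x ≠ 0) : pchi F x = 1 ∨ pchi F x = -1 := by
  rcases quadraticChar_dichotomy hx with h | h <;> simp [pchi, h]

lemma pchi_one_iff {x : F} (hx : x ≠ 0) : pchi F x = 1 ↔ IsSquare x := by
  rw [← quadraticChar_one_iff_isSquare hx]
  unfold pchi; norm_cast

lemma pchi_sum (h : Fintype.card F % 4 = 1) : ∑ x : F, pchi F x = 0 := by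
  have := quadraticChar_sum_zero (p_char_ne_two h)
  unfold pchi; exact_mod_cast this

lemma pchi_sum_sub (h : Fintype.card F % 4 = 1) (d : F) : ∑ x : F, pchi F (d - x) = 0 := by
  rw [← pchi_sum (F := F) h]
  exact Fintype.sum_equiv (Equiv.subLeft d) _ _ (fun x => rfl)

lemma pchi_conv (h : Fintype.card F % 4 = 1) {d : F} (hd : d ≠ 0) :
    ∑ x : F, pchi F x * pchi F (d - x) = -1 := by
  have hj := jacobiSum_nontrivial_inv (quadraticChar_ne_one (p_char_ne_two h))
  rw [(quadraticChar_isQuadratic F).inv] at hj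
  have hn := pchi_neg h (1 : F)
  have h1 : quadraticChar F (-1) = 1 := by
    unfold pchi at hn; simp at hn; exact_mod_cast hn
  rw [h1] at hj
  have hj' : ∑ x : F, pchi F x * pchi F (1 - x) = -1 := by
    unfold jacobiSum at hj; unfold pchi; exact_mod_cast hj
  rw [← hj']
  symm
  refine Fintype.sum_equiv (Equiv.mulLeft₀ d hd) _ _ (fun x => ?_)
  have e : d - d * x = d * (1 - x) := by ring
  have hs := pchi_sq hd
  simp only [Equiv.mulLeft₀_apply, e]
  unfold pchi at *
  simp only [map_mul, Int.cast_mul]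
  linear_combination (-((quadraticChar F x : ℤ) : ℝ) * ((quadraticChar F (1 - x) : ℤ) : ℝ)) * hs

lemma p_adj (h : Fintype.card F % 4 = 1) (a b : F) :
    (paleyGraph F).Adj a b ↔ pchi F (a - b) = 1 := by
  unfold paleyGraph
  rw [SimpleGraph.fromRel_adj]
  by_cases hab : a = b
  · subst hab; simp [pchi_zero]
  · have h1 : a - b ≠ 0 := sub_ne_zero.mpr hab
    have h2 : b - a ≠ 0 := sub_ne_zero.mpr (Ne.symm hab)
    rw [← pchi_one_iff h1, ← pchi_one_iff h2, ← pchi_neg h (b - a), neg_sub]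
    simp [hab]

lemma p_common (h : Fintype.card F % 4 = 1) {d : F} (hd : d ≠ 0) (hd' : pchi F d = -1) :
    ∃ x, pchi F x = 1 ∧ pchi F (d - x) = 1 := by
  by_contra! hc
  have h0 : ∀ x : F, (1 + pchi F x) * (1 + pchi F (d - x)) = 0 := by
    intro x
    by_cases hx : x = 0
    · subst hx; simp [hd']
    by_cases hx2 : d - x = 0
    · have : d = x := sub_eq_zero.mp hx2
      subst this; simp [hd']
    rcases pchi_cases hx with h1 | h1
    · rcases pchi_cases hx2 with h2 | h2
      · exact absurd h2 (hc x h1)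
      · simp [h2]
    · simp [h1]
  have h1 : ∑ x : F, (1 + pchi F x) * (1 + pchi F (d - x)) = (Fintype.card F : ℝ) - 1 := by
    have : ∀ x : F, (1 + pchi F x) * (1 + pchi F (d - x))
      = 1 + pchi F x + pchi F (d - x) + pchi F x * pchi F (d - x) := fun x => by ring
    simp only [this, Finset.sum_add_distrib, pchi_sum h, pchi_sum_sub h, pchi_conv h hd]
    simp; ring
  rw [Finset.sum_eq_zero (fun x _ => h0 x)] at h1
  have h2 : (1 : ℝ) < Fintype.card F := by exact_mod_cast Fintype.one_lt_card
  linarith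

lemma p_dist (h : Fintype.card F % 4 = 1) (a b : F) :
    2 * ((paleyGraph F).dist a b : ℝ) = 3 - pchi F (a - b) - if a = b then 3 else 0 := by
  by_cases hab : a = b
  · subst hab; simp [pchi_zero]
  have hd : a - b ≠ 0 := sub_ne_zero.mpr hab
  rcases pchi_cases hd with h1 | h1
  · have : (paleyGraph F).dist a b = 1 := SimpleGraph.dist_eq_one_iff_adj.mpr ((p_adj h a b).mpr h1)
    simp [this, h1, hab]; norm_num
  · have hna : (paleyGraph F).dist a b ≠ 1 := by
      rw [Ne, SimpleGraph.dist_eq_one_iff_adj, p_adj h, h1]; norm_num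
    obtain ⟨x, hx1, hx2⟩ := p_common h hd h1
    have e1 : (paleyGraph F).Adj a (a - x) := (p_adj h _ _).mpr (by simpa using hx1)
    have e2 : (paleyGraph F).Adj (a - x) b :=
      (p_adj h _ _).mpr (by rw [show a - x - b = a - b - x by ring]; exact hx2)
    have hle := SimpleGraph.dist_le (SimpleGraph.Walk.cons e1 (SimpleGraph.Walk.cons e2 SimpleGraph.Walk.nil))
    have hr : (paleyGraph F).Reachable a b := e1.reachable.trans e2.reachable
    have hp := hr.pos_dist_of_ne hab
    simp at hle
    have : (paleyGraph F).dist a b = 2 := by omega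
    simp [this, h1, hab]; norm_num

lemma p_sconv (h : Fintype.card F % 4 = 1) (a c : F) :
    ∑ b, pchi F (a - b) * pchi F (b - c) = if a = c then (Fintype.card F : ℝ) - 1 else -1 := by
  have e : ∑ b, pchi F (a - b) * pchi F (b - c) = ∑ x, pchi F x * pchi F ((a - c) - x) := by
    refine Fintype.sum_equiv (Equiv.subLeft a) _ _ (fun b => ?_)
    simp
  rw [e]
  split_ifs with hac
  · subst hac
    have : ∀ x : F, pchi F x * pchi F (a - a - x) = 1 - if x = 0 then 1 else 0 := by
      intro x
      by_cases hx : x = 0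
      · simp [hx, pchi_zero]
      · simp [hx, pchi_neg h, pchi_sq hx]
    rw [Finset.sum_congr rfl (fun x _ => this x)]
    simp [Finset.sum_sub_distrib]
  · exact pchi_conv h (sub_ne_zero.mpr hac)

/-- structure of eigenvectors -/
lemma p_eig (h : Fintype.card F % 4 = 1) (v : F → ℝ) (μ : ℝ)
    (hv : distMatrix (paleyGraph F) *ᵥ v = μ • v) :
    ((2 * μ + 3) * ∑ a, v a = 3 * Fintype.card F * ∑ a, v a) ∧
    ∀ a, ((2 * μ + 3) ^ 2 - Fintype.card F) * v a = (9 * Fintype.card F - 1) * ∑ a, v a := by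
  have h1 : ∀ a, (2 * μ + 3) * v a = 3 * ∑ b, v b - ∑ b, pchi F (a - b) * v b := by
    intro a
    have := congrFun hv a
    simp only [Matrix.mulVec, dotProduct, distMatrix, Matrix.of_apply, Pi.smul_apply,
      smul_eq_mul] at this
    have h2 : 2 * (μ * v a) = ∑ b, (3 * v b - pchi F (a - b) * v b - if a = b then 3 * v b else 0) := by
      rw [← this, Finset.mul_sum]
      refine Finset.sum_congr rfl fun b _ => ?_
      rw [← mul_assoc, p_dist h]
      split_ifs <;> ring
    rw [Finset.sum_sub_distrib, Finset.sum_sub_distrib, ← Finset.mul_sum] at h2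
    simp at h2
    linarith
  have hS : ∑ a, ∑ b, pchi F (a - b) * v b = 0 := by
    rw [Finset.sum_comm]
    refine Finset.sum_eq_zero fun b _ => ?_
    rw [← Finset.sum_mul]
    have : ∑ a, pchi F (a - b) = 0 := by
      rw [← pchi_sum_sub h b]
      refine Finset.sum_congr rfl fun a _ => ?_
      rw [← pchi_neg h, neg_sub]
    rw [this, zero_mul]
  have hsum : (2 * μ + 3) * ∑ a, v a = 3 * Fintype.card F * ∑ a, v a := by
    rw [Finset.mul_sum, Finset.sum_congr rfl (fun a _ => h1 a), Finset.sum_sub_distrib, hS]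
    simp; ring
  refine ⟨hsum, fun a => ?_⟩
  have hSS : ∑ b, pchi F (a - b) * ((2 * μ + 3) * v b)
      = - (Fintype.card F * v a - ∑ b, v b) := by
    simp only [h1, mul_sub]
    rw [Finset.sum_sub_distrib, ← Finset.sum_mul, pchi_sum_sub h]
    simp only [Finset.mul_sum, ← mul_assoc]
    rw [Finset.sum_comm]
    simp only [← Finset.sum_mul, p_sconv h]
    have : ∀ c, (if a = c then (Fintype.card F : ℝ) - 1 else -1) * v c
      = (if a = c then Fintype.card F * v c else 0) - v c := by
      intro c; split_ifs <;> ring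
    simp [this, Finset.sum_sub_distrib]
  have h3 : ∑ b, pchi F (a - b) * ((2 * μ + 3) * v b) = (2 * μ + 3) * ∑ b, pchi F (a - b) * v b := by
    rw [Finset.mul_sum]; exact Finset.sum_congr rfl fun b _ => by ring
  rw [h3] at hSS
  linear_combination (2 * μ + 3) * h1 a + 3 * hsum - hSS

end PaleyAux

/-- For a prime power `q ≡ 1 (mod 4)` with `q > 9`, the Paley graph `P(q)` is optimistic:
its distance matrix has strictly more positive than negative eigenvalues. -/
theorem paleyGraph_optimistic (F : Type*) [Field F] [Fintype F] [DecidableEq F]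
    (q : ℕ) (hq : Fintype.card F = q) (hq1 : q % 4 = 1) (hq9 : 9 < q)
    (hD : (distMatrix (paleyGraph F)).IsHermitian) :
    (Finset.univ.filter fun i => hD.eigenvalues i < 0).card <
      (Finset.univ.filter fun i => 0 < hD.eigenvalues i).card := by
  have h : Fintype.card F % 4 = 1 := by rw [hq]; exact hq1
  have hQ : (9 : ℝ) < q := by exact_mod_cast hq9
  set r : ℝ := Real.sqrt q with hr
  have hr2 : r * r = q := Real.mul_self_sqrt (by positivity)
  have hr0 : 0 ≤ r := Real.sqrt_nonneg _
  have hr3 : 3 < r := by nlinarith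
  set v : F → F → ℝ := fun i a => hD.eigenvectorBasis i a with hv
  set l : F → ℝ := fun i => 2 * hD.eigenvalues i + 3 with hl
  have hE : ∀ i, (l i * ∑ a, v i a = 3 * q * ∑ a, v i a) ∧
      ∀ a, ((l i) ^ 2 - q) * v i a = (9 * q - 1) * ∑ a, v i a := by
    intro i
    rw [← hq]
    exact p_eig h (v i) (hD.eigenvalues i) (hD.mulVec_eigenvectorBasis i)
  have hne : ∀ i, ∃ a, v i a ≠ 0 := by
    intro i
    by_contra! hc
    have : hD.eigenvectorBasis i = 0 := by ext a; exact hc a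
    exact hD.eigenvectorBasis.orthonormal.ne_zero i this
  have hcase : ∀ i, l i = 3 * q ∨ l i = r ∨ l i = -r := by
    intro i
    obtain ⟨h1, h2⟩ := hE i
    by_cases hs : ∑ a, v i a = 0
    · right
      obtain ⟨a, ha⟩ := hne i
      have h3 := h2 a
      rw [hs, mul_zero] at h3
      have h4 : (l i - r) * (l i + r) = 0 := by
        have := (mul_eq_zero.mp h3).resolve_right ha
        nlinarith
      rcases mul_eq_zero.mp h4 with h5 | h5
      · left; linarith
      · right; linarith
    · left; exact mul_right_cancel₀ hs h1
  set T : Finset F := Finset.univ.filter fun i => l i = 3 * q with hT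
  have hTc : T.card ≤ 1 := by
    rw [Finset.card_le_one]
    intro i hi j hj
    by_contra hij
    have key : ∀ i ∈ T, ∀ a, q * v i a = ∑ a, v i a := by
      intro i hi a
      have h1 : l i = 3 * q := (Finset.mem_filter.mp hi).2
      have h2 := (hE i).2 a
      rw [h1] at h2
      have h3 : (9 * (q:ℝ) - 1) ≠ 0 := by nlinarith
      apply mul_left_cancel₀ h3
      linear_combination h2
    have hsn : ∀ i ∈ T, ∑ a, v i a ≠ 0 := by
      intro i hi hs
      obtain ⟨a, ha⟩ := hne i
      have := key i hi a
      rw [hs] at this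
      rcases mul_eq_zero.mp this with h1 | h1
      · linarith
      · exact ha h1
    have horth : ∑ a, v i a * v j a = 0 := by
      have := hD.eigenvectorBasis.orthonormal.2 hij
      simp only [PiLp.inner_apply] at this
      rw [← this]
      refine Finset.sum_congr rfl fun a _ => ?_
      simp [hv, mul_comm]
    have h5 : (∑ a, v i a) * (∑ a, v j a) = 0 := by
      have : (q:ℝ) * ∑ a, v i a * v j a = (∑ a, v i a) * (∑ a, v j a) := by
        rw [Finset.sum_mul, Finset.mul_sum]
        refine Finset.sum_congr rfl fun a _ => ?_
        rw [← key j hj a]; ring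
      rw [← this, horth, mul_zero]
    rcases mul_eq_zero.mp h5 with h6 | h6
    · exact hsn i hi h6
    · exact hsn j hj h6
  have htr : ∑ i, hD.eigenvalues i = 0 := by
    have := hD.trace_eq_sum_eigenvalues
    have h0 : (distMatrix (paleyGraph F)).trace = 0 := by simp [Matrix.trace, distMatrix]
    rw [h0] at this
    simpa using this.symm
  have hlsum : ∑ i, l i = 3 * q := by
    simp only [hl, Finset.sum_add_distrib, ← Finset.mul_sum, htr]
    simp [hq]; ring
  have hterm : ∀ i, l i = r * ((if 0 < hD.eigenvalues i then (1:ℝ) else 0)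
      - (if hD.eigenvalues i < 0 then (1:ℝ) else 0)) + (if l i = 3 * q then 3 * q - r else 0) := by
    intro i
    have hli : hD.eigenvalues i = (l i - 3) / 2 := by simp only [hl]; ring
    rcases hcase i with h1 | h1 | h1
    · have : 0 < hD.eigenvalues i := by rw [hli, h1]; linarith
      rw [if_pos this, if_neg this.le.not_gt, if_pos h1, h1]; ring
    · have : 0 < hD.eigenvalues i := by rw [hli, h1]; linarith
      have h3 : l i ≠ 3 * q := by rw [h1]; nlinarith
      rw [if_pos this, if_neg this.le.not_gt, if_neg h3, h1]; ring
    · have : hD.eigenvalues i < 0 := by rw [hli, h1]; linarith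
      have h3 : l i ≠ 3 * q := by rw [h1]; nlinarith
      rw [if_pos this, if_neg this.le.not_gt, if_neg h3, h1]; ring
  rw [Finset.sum_congr rfl (fun i _ => hterm i), Finset.sum_add_distrib, ← Finset.mul_sum,
    Finset.sum_sub_distrib, Finset.sum_boole, Finset.sum_boole, ← Finset.sum_filter,
    Finset.sum_const, nsmul_eq_mul] at hlsum
  have hTc' : (T.card : ℝ) ≤ 1 := by exact_mod_cast hTc
  have h8 : (T.card : ℝ) * (3 * q - r) ≤ 3 * q - r := by
    have : 0 ≤ 3 * (q:ℝ) - r := by nlinarith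
    nlinarith
  by_contra hc
  push Not at hc
  have hc' : ((Finset.univ.filter fun i => 0 < hD.eigenvalues i).card : ℝ) ≤
    ((Finset.univ.filter fun i => hD.eigenvalues i < 0).card : ℝ) := by exact_mod_cast hc
  nlinarith
end

section
/- Let m > 2 be an integer and let G be a connected strongly regular graph with parameters (m², 3(m−1), m, 6). Then the distance matrix D of G satisfies n₊(G) − n₋(G) = m² − 6m + 6; explicitly, D has m²−3m+3 strictly positive and 3m−3 strictly negative eigenvalues. -/
open Matrix Finset

lemma aux_trace_sq {V : Type*} [Fintype V] [DecidableEq V] {D : Matrix V V ℝ}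
    (hD : D.IsHermitian) : (D * D).trace = ∑ i, hD.eigenvalues i ^ 2 := by
  have h := hD.spectral_theorem
  have h2 : D * D = Unitary.conjStarAlgAut ℝ _ hD.eigenvectorUnitary
      (diagonal (hD.eigenvalues) * diagonal (hD.eigenvalues)) := by
    rw [map_mul]
    exact congrArg₂ (· * ·) h h
  rw [h2, Unitary.conjStarAlgAut_apply, Matrix.trace_mul_comm, ← mul_assoc]
  simp [Matrix.trace, sq]

lemma aux_dist {V : Type*} [Fintype V] [DecidableEq V]
    (G : SimpleGraph V) [DecidableRel G.Adj] (m : ℕ)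
    (hsrg : G.IsSRGWith (m ^ 2) (3 * (m - 1)) m 6) :
    distMatrix G = (2 : ℝ) • (Matrix.of fun _ _ => (1 : ℝ)) - (2 : ℝ) • 1 - G.adjMatrix ℝ := by
  ext u v
  simp only [distMatrix, Matrix.of_apply, Matrix.sub_apply, Matrix.smul_apply,
    SimpleGraph.adjMatrix_apply, smul_eq_mul]
  by_cases huv : u = v
  · subst huv; simp
  by_cases ha : G.Adj u v
  · rw [SimpleGraph.dist_eq_one_iff_adj.mpr ha]; simp [huv, ha]; norm_num
  · have h6 := hsrg.of_not_adj huv ha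
    have : Nonempty (G.commonNeighbors u v) := by
      rw [← Fintype.card_pos_iff, h6]; norm_num
    obtain ⟨w, hw⟩ := this
    rw [SimpleGraph.mem_commonNeighbors] at hw
    let p : G.Walk u v := .cons hw.1 (.cons hw.2.symm .nil)
    have hp : G.dist u v ≤ 2 := SimpleGraph.dist_le p
    have h0 : G.dist u v ≠ 0 := fun h => huv (p.reachable.dist_eq_zero_iff.mp h)
    have h1 : G.dist u v ≠ 1 := fun h => ha (SimpleGraph.dist_eq_one_iff_adj.mp h)
    have : G.dist u v = 2 := by omega
    simp [this, huv, ha]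

lemma aux_alg {V : Type*} [Fintype V] [DecidableEq V]
    (G : SimpleGraph V) [DecidableRel G.Adj] (m : ℕ) (hm : 2 < m)
    (hsrg : G.IsSRGWith (m ^ 2) (3 * (m - 1)) m 6) (J : Matrix V V ℝ)
    (hJ : J = Matrix.of fun _ _ => (1 : ℝ)) :
    distMatrix G * J = ((2 * (m : ℝ) - 1) * (m - 1)) • J ∧
    distMatrix G * distMatrix G = ((m : ℝ) - 1) • (1 : Matrix V V ℝ) +
      (2 - (m : ℝ)) • distMatrix G + (2 * (2 * (m : ℝ) - 3) * (m - 1)) • J := by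
  have hc : ((m - 1 : ℕ) : ℝ) = (m : ℝ) - 1 := by
    rw [Nat.cast_sub (by omega)]; simp
  have hA := hsrg.matrix_eq (α := ℝ)
  have hcompl : Gᶜ.adjMatrix ℝ = J - 1 - G.adjMatrix ℝ := by
    subst hJ
    ext u v
    by_cases huv : u = v
    · subst huv; simp
    · by_cases ha : G.Adj u v <;> simp [huv, ha]
  rw [hcompl, sq, ← Nat.cast_smul_eq_nsmul ℝ, ← Nat.cast_smul_eq_nsmul ℝ,
    ← Nat.cast_smul_eq_nsmul ℝ] at hA
  push_cast at hA
  rw [hc] at hA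
  have hJJ : J * J = ((m : ℝ) ^ 2) • J := by
    subst hJ
    ext u v
    simp [Matrix.mul_apply, hsrg.card]
  have hAJ : G.adjMatrix ℝ * J = (3 * ((m : ℝ) - 1)) • J := by
    subst hJ
    ext u v
    simp [hsrg.regular u, hc]
  have hJA : J * G.adjMatrix ℝ = (3 * ((m : ℝ) - 1)) • J := by
    subst hJ
    ext u v
    simp [hsrg.regular v, hc]
  rw [aux_dist G m hsrg, ← hJ]
  constructor
  · simp only [sub_mul, smul_mul_assoc, one_mul, hJJ, hAJ]
    module
  · simp only [sub_mul, mul_sub, smul_mul_assoc, mul_smul_comm, one_mul, mul_one, hJJ, hAJ, hJA, hA]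
    module

/-- For `m > 2` and a connected strongly regular graph with parameters
`(m², 3(m-1), m, 6)`, the distance matrix has `m² - 3m + 3` strictly positive and `3m - 3`
strictly negative eigenvalues; in particular `n₊(G) - n₋(G) = m² - 6m + 6`. -/
theorem srg_m_sq_distMatrix_inertia {V : Type*} [Fintype V] [DecidableEq V]
    (G : SimpleGraph V) [DecidableRel G.Adj] (m : ℕ) (hm : 2 < m)
    (hsrg : G.IsSRGWith (m ^ 2) (3 * (m - 1)) m 6) (hconn : G.Connected)
    (hD : (distMatrix G).IsHermitian) :
    (Finset.univ.filter fun i => 0 < hD.eigenvalues i).card = m ^ 2 - 3 * m + 3 ∧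
    (Finset.univ.filter fun i => hD.eigenvalues i < 0).card = 3 * m - 3 ∧
    ((Finset.univ.filter fun i => 0 < hD.eigenvalues i).card : ℤ) -
        ((Finset.univ.filter fun i => hD.eigenvalues i < 0).card : ℤ) =
      (m : ℤ) ^ 2 - 6 * m + 6 := by
  obtain ⟨h1, h2⟩ := aux_alg G m hm hsrg _ rfl
  have hM : (3 : ℝ) ≤ m := by exact_mod_cast hm
  have htr2 := aux_trace_sq hD
  have htr := hD.trace_eq_sum_eigenvalues
  have htr0 : (distMatrix G).trace = 0 := by simp [Matrix.trace, distMatrix]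
  have htrJ : (Matrix.of fun _ _ => (1 : ℝ) : Matrix V V ℝ).trace = (m : ℝ) ^ 2 := by
    simp [Matrix.trace, hsrg.card]
  rw [h2] at htr2
  simp only [Matrix.trace_add, Matrix.trace_smul, htr0, htrJ, Matrix.trace_one, hsrg.card,
    smul_eq_mul] at htr2
  rw [htr0] at htr
  simp only [RCLike.ofReal_real_eq_id, id] at htr
  generalize hJ : (Matrix.of fun _ _ => (1 : ℝ) : Matrix V V ℝ) = J at *
  have hroot : ∀ i, hD.eigenvalues i = (2 * (m : ℝ) - 1) * (m - 1) ∨ hD.eigenvalues i = 1 ∨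
      hD.eigenvalues i = -((m : ℝ) - 1) := by
    intro i
    have hv := hD.mulVec_eigenvectorBasis i
    have hne : (⇑(hD.eigenvectorBasis i) : V → ℝ) ≠ 0 := by
      intro h
      apply hD.eigenvectorBasis.orthonormal.ne_zero i
      ext j; exact congrFun h j
    generalize hD.eigenvalues i = e at *
    generalize (⇑(hD.eigenvectorBasis i) : V → ℝ) = v at *
    have hc0 : 2 * (2 * (m : ℝ) - 3) * (m - 1) ≠ 0 := by
      have : (0:ℝ) < 2 * (2 * (m : ℝ) - 3) * (m - 1) :=
        mul_pos (by linarith) (by linarith)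
      exact this.ne'
    have e2 := congrArg (fun X => X *ᵥ v) h2
    simp only [← Matrix.mulVec_mulVec, hv, Matrix.add_mulVec, Matrix.smul_mulVec,
      Matrix.mulVec_smul, Matrix.one_mulVec] at e2
    set c := 2 * (2 * (m : ℝ) - 3) * (m - 1)
    have hJv : c • (J *ᵥ v) = ((e - 1) * (e + (m - 1))) • v := by
      have : c • (J *ᵥ v) = e • e • v - (((m:ℝ) - 1) • v + (2 - (m:ℝ)) • e • v) := by
        rw [e2]; abel
      rw [this]; module
    have e3 := congrArg (fun X => distMatrix G *ᵥ X) hJv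
    simp only [Matrix.mulVec_smul, Matrix.mulVec_mulVec, h1, hv] at e3
    rw [Matrix.smul_mulVec, smul_comm, hJv] at e3
    have e4 : ((e - (2 * (m : ℝ) - 1) * (m - 1)) * ((e - 1) * (e + (m - 1)))) • v = 0 := by
      rw [← sub_eq_zero] at e3
      rw [← neg_eq_zero, ← e3]; module
    rcases smul_eq_zero.mp e4 with h | h
    · rcases mul_eq_zero.mp h with h | h
      · left; linarith
      · rcases mul_eq_zero.mp h with h | h
        · right; left; linarith
        · right; right; linarith
    · exact absurd h hne
  set θ := (2 * (m : ℝ) - 1) * (m - 1) with hθ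
  have hθ1 : 1 < θ := by nlinarith
  -- indicator sums
  have hcard : (Fintype.card V : ℝ) = (m : ℝ) ^ 2 := by rw [hsrg.card]; push_cast; rfl
  have key : ∑ i, (if hD.eigenvalues i < 0 then (1 : ℝ) else 0) = 3 * m - 3 := by
    have hneg : ∀ i, (θ + (m - 1)) * m * (if hD.eigenvalues i < 0 then (1 : ℝ) else 0) =
        (hD.eigenvalues i ^ 2 - (1 + θ) * hD.eigenvalues i + θ) := by
      intro i
      rcases hroot i with h | h | h
      · rw [h, if_neg (by linarith)]; ring
      · rw [h, if_neg (by linarith)]; ring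
      · rw [h, if_pos (by linarith)]; ring
    have hs : (θ + (m - 1)) * m * ∑ i, (if hD.eigenvalues i < 0 then (1 : ℝ) else 0) =
        (θ + (m - 1)) * m * (3 * m - 3) := by
      rw [Finset.mul_sum, Finset.sum_congr rfl (fun i _ => hneg i), Finset.sum_add_distrib,
        Finset.sum_sub_distrib, ← Finset.mul_sum, ← htr2, ← htr]
      simp only [Finset.sum_const, Finset.card_univ, nsmul_eq_mul, hcard]
      push_cast
      rw [hθ]; ring
    exact mul_left_cancel₀ (mul_pos (by linarith) (by linarith)).ne' hs
  have hnegc : (Finset.univ.filter fun i => hD.eigenvalues i < 0).card = 3 * m - 3 := by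
    rw [Finset.sum_boole] at key
    have : (((Finset.univ.filter fun i => hD.eigenvalues i < 0).card + 3 : ℕ) : ℝ)
      = ((3 * m : ℕ) : ℝ) := by push_cast; linarith
    have := Nat.cast_injective this
    omega
  have hsum : (Finset.univ.filter fun i => 0 < hD.eigenvalues i).card +
      (Finset.univ.filter fun i => hD.eigenvalues i < 0).card = m ^ 2 := by
    rw [← hsrg.card, ← Finset.card_univ, 
      ← Finset.card_filter_add_card_filter_not (s := Finset.univ) (fun i => 0 < hD.eigenvalues i)]
    congr 2
    ext i
    simp only [Finset.mem_filter, Finset.mem_univ, true_and, not_lt]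
    rcases hroot i with h | h | h <;> rw [h] <;> constructor <;> intro h' <;> linarith
  have hge : 3 * m ≤ m ^ 2 := by nlinarith
  refine ⟨by omega, hnegc, ?_⟩
  zify [show 3 ≤ 3 * m by omega] at hnegc hsum
  linarith
end
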